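/- arXiv:2509.17077 — 2 statements merged into one kernel-verified Lean document; each statement's English description precedes it below -/
import Mathlib

section
/- Prescribed Ritz values of each cycle of restarted GMRES: Let m, ℓ ≥ 1 and n = ℓm. Let {f_j^(k)} (j = 0,…,m−1; k = 1,…,ℓ) be positive real numbers that are strictly decreasing within each cycle and satisfy f_{m−1}^(k) > f_0^(k+1) for k = 1,…,ℓ−1, and for each cycle k and each step j = 1,…,m let θ_{j,1}^(k), …, θ_{j,j}^(k) be arbitrary nonzero complex numbers. Then there exist A ∈ ℂ^{n×n}, b ∈ ℂ^n, matrices V^(k) ∈ ℂ^{n×m} with orthonormal columns, unit vectors w_k ∈ ℂ^n orthogonal to the columns of V^(k), and upper Hessenberg matrices H̲^(k) ∈ ℂ^{(m+1)×m} with positive subdiagonal entries, such that: b = f_0^(1) V^(1)e₁; A V^(k) = [V^(k), w_k] H̲^(k) for k = 1,…,ℓ−1 and A V^(ℓ) = V^(ℓ) H^(ℓ), where H^(k) is the m×m leading part of H̲^(k); restarted GMRES with cycle length m applied to Ax = b yields ‖r_j^(k)‖ = f_j^(k) for all j = 0,…,m−1 and k = 1,…,ℓ; and for every k and every j = 1,…,m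 the characteristic polynomial of the j×j leading principal submatrix of H^(k) equals ∏_{i=1}^j (z − θ_{j,i}^(k)). In particular the Ritz values of each cycle can be assigned arbitrarily, independently of the prescribed residual norms. -/
open Matrix Polynomial

/-- The Euclidean 2-norm of a vector in `ℂ^n`. -/
noncomputable def norm2 {n : ℕ} (v : Fin n → ℂ) : ℝ :=
  ‖(WithLp.equiv 2 (Fin n → ℂ)).symm v‖

/-- `r` is the GMRES residual at step `j` for matrix `A` and initial residual `r0`:
it belongs to `{p(A) r0 : deg p ≤ j, p(0) = 1}` and has minimal Euclidean norm there. -/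
def IsGMRESResidual {n : ℕ} (A : Matrix (Fin n) (Fin n) ℂ) (r0 : Fin n → ℂ)
    (j : ℕ) (r : Fin n → ℂ) : Prop :=
  (∃ p : Polynomial ℂ, p.natDegree ≤ j ∧ p.eval 0 = 1 ∧ r = (aeval A p).mulVec r0) ∧
  ∀ q : Polynomial ℂ, q.natDegree ≤ j → q.eval 0 = 1 →
    norm2 r ≤ norm2 ((aeval A q).mulVec r0)

section Polynomials

/-- A sequence of polynomials with `deg (q i) = i` spans every space of polynomials of bounded
degree. -/
lemma exists_coeff_eq_sum_of_natDegree_eq {q : ℕ → ℂ[X]} (hq : ∀ i, (q i).natDegree = i)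
    (hq0 : ∀ i, q i ≠ 0) (J : ℕ) (p : ℂ[X]) (hp : p.natDegree ≤ J) :
    ∃ a : ℕ → ℂ, p = ∑ i ∈ Finset.range (J + 1), C (a i) * q i := by
  induction J generalizing p with
  | zero =>
    obtain ⟨c, hc⟩ := natDegree_eq_zero.1 (Nat.le_zero.1 hp)
    obtain ⟨d, hd⟩ := natDegree_eq_zero.1 (hq 0)
    have hd0 : d ≠ 0 := by
      rintro rfl
      exact hq0 0 (by rw [← hd, C_0])
    refine ⟨fun _ => c / d, ?_⟩
    rw [zero_add, Finset.sum_range_one, ← hc, ← hd, ← C_mul, div_mul_cancel₀ _ hd0]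
  | succ J ih =>
    have hlead : (q (J + 1)).coeff (J + 1) ≠ 0 := by
      have := leadingCoeff_ne_zero.2 (hq0 (J + 1))
      rwa [leadingCoeff, hq] at this
    set c := p.coeff (J + 1) / (q (J + 1)).coeff (J + 1) with hc
    obtain ⟨a, ha⟩ := ih (p - C c * q (J + 1)) (by
      rw [natDegree_le_iff_coeff_eq_zero]
      intro N hN
      rw [coeff_sub, coeff_C_mul]
      rcases Nat.lt_or_ge (J + 1) N with h | h
      · rw [coeff_eq_zero_of_natDegree_lt (by omega : p.natDegree < N),
          coeff_eq_zero_of_natDegree_lt (by rw [hq]; exact h : (q (J + 1)).natDegree < N)]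
        simp
      · obtain rfl : N = J + 1 := by omega
        rw [hc, div_mul_cancel₀ _ hlead, sub_self])
    refine ⟨fun i => if i = J + 1 then c else a i, ?_⟩
    simp only
    rw [Finset.sum_range_succ, if_pos rfl, Finset.sum_congr rfl
      (g := fun i => C (a i) * q i) (fun i hi => by
        rw [if_neg (by have := Finset.mem_range.1 hi; omega)]), ← ha]
    ring

/-- The leading principal submatrices of a Hessenberg matrix that represents multiplication by `X`
in the basis `q` have the polynomials `q n` as characteristic polynomials, up to scaling. -/
lemma charpoly_hessenberg {q : ℕ → ℂ[X]} {H : ℕ → ℕ → ℂ} (hq0 : q 0 = 1)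
    (hH : ∀ i j, j + 1 < i → H i j = 0)
    (hX : ∀ j, X * q j = ∑ i ∈ Finset.range (j + 2), C (H i j) * q i) (n : ℕ) :
    (Matrix.of fun a b : Fin n => H a b).charpoly =
      (∏ i ∈ Finset.range n, C (H (i + 1) i)) * q n := by
  cases n with
  | zero => simp [hq0]
  | succ n =>
    set M := (Matrix.of fun a b : Fin (n + 1) => H a b).charmatrix with hM
    have hentry : ∀ a b : Fin (n + 1), M a b = (if a = b then X else 0) - C (H a b) := by
      intro a b
      rw [hM, charmatrix_apply, Matrix.diagonal_apply]
      rfl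
    have hrow : ∀ b : Fin (n + 1), (∑ k : Fin (n + 1), q k • M k) b =
        if b = Fin.last n then C (H (n + 1) n) * q (n + 1) else 0 := by
      intro b
      have h1 : (∑ k : Fin (n + 1), q k • M k) b = X * q b - ∑ k : Fin (n + 1), C (H k b) * q k := by
        rw [Finset.sum_apply]
        simp only [Pi.smul_apply, smul_eq_mul, hentry, mul_sub, Finset.sum_sub_distrib]
        congr 1
        · simp [mul_comm]
        · exact Finset.sum_congr rfl fun _ _ => mul_comm _ _
      rw [h1, hX, Fin.sum_univ_eq_sum_range (fun k => C (H k b) * q k)]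
      split_ifs with hb
      · subst hb
        rw [Fin.val_last, Finset.sum_range_succ _ (n + 1), add_sub_cancel_left]
      · have hb' : (b : ℕ) < n := by
          have := b.2
          have : (b : ℕ) ≠ n := fun h => hb (Fin.ext h)
          omega
        rw [sub_eq_zero]
        refine Finset.sum_subset (fun x hx => ?_) fun x _ hx => ?_
        · rw [Finset.mem_range] at hx ⊢
          omega
        · rw [Finset.mem_range] at hx
          rw [hH _ _ (by omega), C_0, zero_mul]
    have hdet : (M.updateRow 0 (∑ k : Fin (n + 1), q k • M k)).det = M.det := by
      rw [det_updateRow_sum, Fin.val_zero, hq0, one_smul]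
    have hsub : (((M.updateRow 0 (∑ k : Fin (n + 1), q k • M k)).submatrix Fin.succ
        (Fin.last n).succAbove)).det = ∏ i : Fin n, - C (H (i + 1) i) := by
      rw [det_of_isUpperTriangular]
      · refine Finset.prod_congr rfl fun i _ => ?_
        rw [submatrix_apply, updateRow_ne (Fin.succ_ne_zero i), hentry, Fin.succAbove_last,
          if_neg (by simp [Fin.ext_iff]), zero_sub]
        rfl
      · intro i j hij
        have hij' : (j : ℕ) < i := hij
        rw [submatrix_apply, updateRow_ne (Fin.succ_ne_zero i), hentry, Fin.succAbove_last,
          if_neg (by rw [Fin.ext_iff]; simp; omega), hH _ _ (by simp; omega)]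
        simp
    change M.det = _
    rw [← hdet, det_succ_row_zero, Finset.sum_eq_single (Fin.last n)]
    · rw [updateRow_self, hrow, if_pos rfl, hsub, Finset.prod_neg, Finset.prod_range_succ,
        ← Fin.prod_univ_eq_prod_range (fun i => C (H (i + 1) i)), Finset.card_univ,
        Fintype.card_fin, Fin.val_last]
      have : (-1 : ℂ[X]) ^ n * (-1) ^ n = 1 := by rw [← mul_pow]; simp
      linear_combination (C (H (n + 1) n) * q (n + 1) * ∏ i : Fin n, C (H (i + 1) i)) * this
    · intro b _ hb
      rw [updateRow_self, hrow, if_neg hb]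
      simp
    · simp

end Polynomials

section Residuals

variable {N : ℕ}

lemma norm2_sq (x : Fin N → ℂ) : ((norm2 x ^ 2 : ℝ) : ℂ) = star x ⬝ᵥ x := by
  rw [norm2, EuclideanSpace.norm_sq_eq]
  simp [dotProduct, Complex.conj_mul']

lemma norm2_nonneg (x : Fin N → ℂ) : 0 ≤ norm2 x := norm_nonneg _

lemma norm2_eq_zero {x : Fin N → ℂ} : norm2 x = 0 ↔ x = 0 := by
  rw [norm2, norm_eq_zero]
  simp

lemma norm2_sub_sq {x y : Fin N → ℂ} (h : star x ⬝ᵥ y = star x ⬝ᵥ x) :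
    norm2 (y - x) ^ 2 = norm2 y ^ 2 - norm2 x ^ 2 := by
  have h' : star y ⬝ᵥ x = star x ⬝ᵥ x := by
    rw [star_dotProduct, h, ← star_dotProduct]
  rw [← Complex.ofReal_inj]
  push_cast [-Complex.ofReal_pow]
  simp only [norm2_sq]
  rw [star_sub, sub_dotProduct, dotProduct_sub, dotProduct_sub, h, h']
  ring

lemma isGMRESResidual_unique {A : Matrix (Fin N) (Fin N) ℂ} {r0 x : Fin N → ℂ} {j : ℕ}
    (hx : ∃ p : ℂ[X], p.natDegree ≤ j ∧ p.eval 0 = 1 ∧ x = aeval A p *ᵥ r0)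
    (horth : ∀ q : ℂ[X], q.natDegree ≤ j → q.eval 0 = 1 →
      star x ⬝ᵥ (aeval A q *ᵥ r0) = star x ⬝ᵥ x)
    {r : Fin N → ℂ} (hr : IsGMRESResidual A r0 j r) : r = x := by
  obtain ⟨⟨q, hq, hq0, rfl⟩, hmin⟩ := hr
  obtain ⟨p, hp, hp0, hpx⟩ := hx
  have h1 := hmin p hp hp0
  rw [← hpx] at h1
  have h2 := norm2_sub_sq (horth q hq hq0)
  have h3 : norm2 (aeval A q *ᵥ r0 - x) = 0 := by
    have := norm2_nonneg (aeval A q *ᵥ r0)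
    rw [← sq_eq_zero_iff]
    nlinarith [sq_nonneg (norm2 (aeval A q *ᵥ r0 - x))]
  exact sub_eq_zero.1 (norm2_eq_zero.1 h3)

lemma exists_isGMRESResidual (A : Matrix (Fin N) (Fin N) ℂ) (r0 : Fin N → ℂ) (j : ℕ) :
    ∃ r, IsGMRESResidual A r0 j r := by
  let L : ℂ[X] →ₗ[ℂ] EuclideanSpace ℂ (Fin N) :=
    { toFun := fun s => WithLp.toLp 2 (aeval A (X * s) *ᵥ r0)
      map_add' := fun s t => by rw [mul_add, map_add, add_mulVec]; rfl
      map_smul' := fun c s => by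
        rw [mul_smul_comm, map_smul, smul_mulVec]; rfl }
  let K := (degreeLT ℂ j).map L
  let y : EuclideanSpace ℂ (Fin N) := WithLp.toLp 2 r0
  have hstep : ∀ s ∈ degreeLT ℂ j, (1 - X * s).natDegree ≤ j ∧ (1 - X * s).eval 0 = 1 ∧
      y - L s = WithLp.toLp 2 (aeval A (1 - X * s) *ᵥ r0) := by
    intro s hs
    refine ⟨?_, by simp, ?_⟩
    · rw [mem_degreeLT] at hs
      refine (natDegree_sub_le _ _).trans ?_
      rw [natDegree_one]
      by_cases h0 : s = 0
      · simp [h0]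
      · rw [natDegree_X_mul h0]
        have := (natDegree_lt_iff_degree_lt h0).2 hs
        omega
    · rw [map_sub, map_one, sub_mulVec, one_mulVec]
      rfl
  obtain ⟨s, hs, hsP⟩ := Submodule.mem_map.1 (K.starProjection_apply_mem y)
  obtain ⟨h1, h2, h3⟩ := hstep s hs
  refine ⟨_, ⟨1 - X * s, h1, h2, rfl⟩, fun q hq hq0 => ?_⟩
  obtain ⟨t, ht⟩ : X ∣ 1 - q := by
    rw [X_dvd_iff, coeff_zero_eq_eval_zero]
    simp [hq0]
  have htmem : t ∈ degreeLT ℂ j := by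
    rw [mem_degreeLT]
    by_cases h0 : t = 0
    · rw [h0, degree_zero]; exact WithBot.bot_lt_coe _
    · rw [← natDegree_lt_iff_degree_lt h0]
      have h4 := natDegree_X_mul h0
      rw [← ht] at h4
      have := natDegree_sub_le (1 : ℂ[X]) q
      rw [natDegree_one] at this
      omega
  have hqt : q = 1 - X * t := by rw [← ht]; ring
  have hy := K.starProjection_minimal y
  have hle : ‖y - L s‖ ≤ ‖y - L t‖ := by
    rw [hsP, hy]
    exact ciInf_le (f := fun x : K => ‖y - x‖) ⟨0, by rintro _ ⟨x, rfl⟩; exact norm_nonneg _⟩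
      ⟨L t, Submodule.mem_map_of_mem htmem⟩
  rw [h3, (hstep t htmem).2.2, ← hqt] at hle
  exact hle

lemma star_sum_smul_dotProduct_sum_smul {v : ℕ → Fin N → ℂ} {J : ℕ}
    (horth : ∀ i ≤ J, ∀ j ≤ J, star (v i) ⬝ᵥ v j = if i = j then 1 else 0) (b a : ℕ → ℂ) :
    star (∑ i ∈ Finset.range (J + 1), b i • v i) ⬝ᵥ (∑ i ∈ Finset.range (J + 1), a i • v i) =
      ∑ i ∈ Finset.range (J + 1), star (b i) * a i := by
  rw [star_sum, sum_dotProduct]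
  refine Finset.sum_congr rfl fun i hi => ?_
  have hi' := Finset.mem_range.1 hi
  rw [star_smul, smul_dotProduct, dotProduct_sum, smul_eq_mul, Finset.sum_eq_single i]
  · rw [dotProduct_smul, horth i (by omega) i (by omega), if_pos rfl, smul_eq_mul, mul_one]
  · intro j hj hji
    rw [Finset.mem_range] at hj
    rw [dotProduct_smul, horth i (by omega) j (by omega), if_neg hji.symm, smul_zero]
  · exact fun h => absurd hi h

/-- If scaled polynomials of the Arnoldi process map the initial vector to an orthonormal basis,
then the GMRES residual is explicitly known. -/
lemma isGMRESResidual_eq_sum {A : Matrix (Fin N) (Fin N) ℂ} {v : ℕ → Fin N → ℂ} {q : ℕ → ℂ[X]}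
    (hdeg : ∀ i, (q i).natDegree = i) (hne : ∀ i, q i ≠ 0) {J : ℕ}
    (horth : ∀ i ≤ J, ∀ j ≤ J, star (v i) ⬝ᵥ v j = if i = j then 1 else 0)
    (hv : ∀ i ≤ J, aeval A (q i) *ᵥ v 0 = v i) {α β : ℝ} (hα : 0 < α) (hβ : 0 < β)
    (hsum : ∑ i ∈ Finset.range (J + 1), ‖(q i).eval 0‖ ^ 2 = α ^ 2 / β ^ 2)
    {r : Fin N → ℂ} (hr : IsGMRESResidual A ((α : ℂ) • v 0) J r) :
    r = ((β ^ 2 / α : ℝ) : ℂ) • ∑ i ∈ Finset.range (J + 1), star ((q i).eval 0) • v i ∧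
      norm2 r = β := by
  have hα' : (α : ℂ) ≠ 0 := by exact_mod_cast hα.ne'
  have hβ' : (β : ℂ) ≠ 0 := by exact_mod_cast hβ.ne'
  set x := ((β ^ 2 / α : ℝ) : ℂ) • ∑ i ∈ Finset.range (J + 1), star ((q i).eval 0) • v i with hx
  have hsumC : ∑ i ∈ Finset.range (J + 1), (q i).eval 0 * star ((q i).eval 0) =
      (α : ℂ) ^ 2 / (β : ℂ) ^ 2 := by
    rw [← Complex.ofReal_pow, ← Complex.ofReal_pow, ← Complex.ofReal_div, ← hsum]
    push_cast
    exact Finset.sum_congr rfl fun i _ => Complex.mul_conj' _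
  have hdot : ∀ a : ℕ → ℂ, star x ⬝ᵥ (∑ i ∈ Finset.range (J + 1), a i • v i) =
      ((β ^ 2 / α : ℝ) : ℂ) * ∑ i ∈ Finset.range (J + 1), (q i).eval 0 * a i := by
    intro a
    rw [hx, star_smul, smul_dotProduct, star_sum_smul_dotProduct_sum_smul horth, smul_eq_mul]
    simp only [star_star]
    congr 1
    exact Complex.conj_ofReal _
  have hpoly : ∀ a : ℕ → ℂ, aeval A (∑ i ∈ Finset.range (J + 1), C (a i) * q i) *ᵥ
      ((α : ℂ) • v 0) = ∑ i ∈ Finset.range (J + 1), (α * a i) • v i := by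
    intro a
    rw [map_sum, sum_mulVec]
    refine Finset.sum_congr rfl fun i hi => ?_
    rw [Finset.mem_range] at hi
    rw [C_mul', map_smul, mulVec_smul, smul_mulVec, hv i (by omega), smul_smul]
  have hxx : star x ⬝ᵥ x = (β : ℂ) ^ 2 := by
    conv_lhs => rw [hx]
    rw [dotProduct_smul, ← hx, hdot, hsumC]
    push_cast
    simp only [smul_eq_mul]
    field_simp
  have hrx : r = x := by
    refine isGMRESResidual_unique ⟨∑ i ∈ Finset.range (J + 1),
      C ((β : ℂ) ^ 2 / α ^ 2 * star ((q i).eval 0)) * q i, ?_, ?_, ?_⟩ ?_ hr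
    · refine natDegree_sum_le_of_forall_le _ _ fun i hi => ?_
      rw [Finset.mem_range] at hi
      refine (natDegree_C_mul_le _ _).trans ?_
      rw [hdeg]
      omega
    · rw [eval_finsetSum]
      calc _ = (β : ℂ) ^ 2 / α ^ 2 *
            ∑ i ∈ Finset.range (J + 1), (q i).eval 0 * star ((q i).eval 0) := by
            rw [Finset.mul_sum]
            refine Finset.sum_congr rfl fun i _ => ?_
            rw [eval_mul, eval_C]
            ring
        _ = 1 := by
            rw [hsumC]
            field_simp
    · rw [hpoly, hx, Finset.smul_sum]
      refine Finset.sum_congr rfl fun i _ => ?_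
      rw [smul_smul]
      congr 1
      push_cast
      field_simp
    · intro p hp hp0
      obtain ⟨a, rfl⟩ := exists_coeff_eq_sum_of_natDegree_eq hdeg hne J p hp
      rw [hpoly, hdot, hxx]
      have h1 : ∑ i ∈ Finset.range (J + 1), (q i).eval 0 * (α * a i) = α := by
        rw [eval_finsetSum] at hp0
        calc _ = (α : ℂ) * ∑ i ∈ Finset.range (J + 1), eval 0 (C (a i) * q i) := by
              rw [Finset.mul_sum]
              refine Finset.sum_congr rfl fun i _ => ?_
              rw [eval_mul, eval_C]
              ring
          _ = α := by rw [hp0, mul_one]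
      rw [h1]
      push_cast
      field_simp
  refine ⟨hrx, ?_⟩
  have h2 := norm2_sq r
  rw [hrx, hxx, ← hrx, ← Complex.ofReal_pow, Complex.ofReal_inj] at h2
  exact (sq_eq_sq₀ (norm2_nonneg _) hβ.le).1 h2

/-- The Arnoldi vectors are polynomials of the matrix applied to the first one. -/
lemma aeval_mulVec_eq_of_arnoldi {A : Matrix (Fin N) (Fin N) ℂ} {v : ℕ → Fin N → ℂ}
    {q : ℕ → ℂ[X]} {H : ℕ → ℕ → ℂ} (hq0 : q 0 = 1)
    (hX : ∀ j, X * q j = ∑ i ∈ Finset.range (j + 2), C (H i j) * q i) {J : ℕ}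
    (hsub : ∀ j < J, H (j + 1) j ≠ 0)
    (hA : ∀ j < J, A *ᵥ v j = ∑ i ∈ Finset.range (j + 2), H i j • v i) :
    ∀ i ≤ J, aeval A (q i) *ᵥ v 0 = v i := by
  intro i
  induction i using Nat.strong_induction_on with
  | _ i ih =>
    intro hi
    cases i with
    | zero => rw [hq0, map_one, one_mulVec]
    | succ j =>
      have h1 : aeval A (X * q j) *ᵥ v 0 = A *ᵥ v j := by
        rw [map_mul, aeval_X, ← mulVec_mulVec, ih j (by omega) (by omega)]
      rw [hX, hA j (by omega), map_sum, sum_mulVec, Finset.sum_range_succ,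
        Finset.sum_range_succ _ (j + 1)] at h1
      have h2 : ∑ i ∈ Finset.range (j + 1), aeval A (C (H i j) * q i) *ᵥ v 0 =
          ∑ i ∈ Finset.range (j + 1), H i j • v i := by
        refine Finset.sum_congr rfl fun i hi' => ?_
        rw [Finset.mem_range] at hi'
        rw [C_mul', map_smul, smul_mulVec, ih i (by omega) (by omega)]
      rw [h2, add_right_inj, C_mul', map_smul, smul_mulVec] at h1
      exact smul_right_injective _ (hsub j (by omega)) h1

end Residuals

section Construction

/-- A Hessenberg matrix with prescribed Ritz values, whose scaled Arnoldi polynomials `q i` have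
values at `0` matching prescribed decreasing residual norms. -/
lemma exists_hessenberg (m : ℕ) (f : ℕ → ℝ) (hpos : ∀ j ≤ m, 0 < f j)
    (hdec : ∀ j < m, f (j + 1) < f j) (θ : ℕ → ℕ → ℂ) (hθ : ∀ j ≤ m, ∀ i < j, θ j i ≠ 0) :
    ∃ (q : ℕ → ℂ[X]) (H : ℕ → ℕ → ℂ), q 0 = 1 ∧ (∀ i, (q i).natDegree = i) ∧ (∀ i, q i ≠ 0) ∧
      (∀ i ≤ m, (q i).eval 0 ≠ 0) ∧
      (∀ i j, j + 1 < i → H i j = 0) ∧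
      (∀ j, 0 < (H (j + 1) j).re ∧ (H (j + 1) j).im = 0) ∧
      (∀ j, X * q j = ∑ i ∈ Finset.range (j + 2), C (H i j) * q i) ∧
      (∀ J ≤ m, ∑ i ∈ Finset.range (J + 1), ‖(q i).eval 0‖ ^ 2 = f 0 ^ 2 / f J ^ 2) ∧
      ∀ n, (Matrix.of fun a b : Fin n => H a b).charpoly = ∏ i : Fin n, (X - C (θ n i)) := by
  set p : ℕ → ℂ[X] := fun n => ∏ i : Fin n, (X - C (θ n i)) with hp
  have hmonic : ∀ n, (p n).Monic := fun n => monic_prod_of_monic _ _ fun i _ => monic_X_sub_C _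
  have hpdeg : ∀ n, (p n).natDegree = n := fun n => by
    rw [hp, natDegree_prod_of_monic _ _ fun i _ => monic_X_sub_C _]
    simp
  have hp0 : ∀ n ≤ m, (p n).eval 0 ≠ 0 := fun n hn => by
    rw [hp, eval_prod, Finset.prod_ne_zero_iff]
    intro i _
    simpa using hθ n hn i i.2
  set d : ℕ → ℝ := fun n => Nat.casesOn n 1 fun j => f 0 ^ 2 / f (j + 1) ^ 2 - f 0 ^ 2 / f j ^ 2
    with hd
  have hf0 : 0 < f 0 := hpos 0 (Nat.zero_le m)
  have hdpos : ∀ n ≤ m, 0 < d n := by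
    intro n hn
    cases n with
    | zero => exact one_pos
    | succ j =>
      have h1 := hpos j (by omega)
      have h2 := hpos (j + 1) hn
      have h3 := hdec j (by omega)
      exact sub_pos.2 (by gcongr)
  set τ : ℕ → ℝ := fun n => if n ≤ m then √(d n) / ‖(p n).eval 0‖ else 1 with hτ
  have hτpos : ∀ n, 0 < τ n := by
    intro n
    simp only [hτ]
    split_ifs with h
    · exact div_pos (Real.sqrt_pos.2 (hdpos n h)) (norm_pos_iff.2 (hp0 n h))
    · exact one_pos
  have hτC : ∀ n, (τ n : ℂ) ≠ 0 := fun n => by exact_mod_cast (hτpos n).ne'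
  have hτ0 : τ 0 = 1 := by simp [hτ, hd, hp]
  set q : ℕ → ℂ[X] := fun n => C (τ n : ℂ) * p n with hq
  have hq0 : q 0 = 1 := by simp [hq, hτ0, hp]
  have hqdeg : ∀ n, (q n).natDegree = n := fun n => by
    rw [hq, natDegree_C_mul (hτC n), hpdeg]
  have hqne : ∀ n, q n ≠ 0 := fun n => mul_ne_zero (C_ne_zero.2 (hτC n)) (hmonic n).ne_zero
  have hqlead : ∀ n, (q n).coeff n = τ n := fun n => by
    have := (hmonic n).coeff_natDegree
    rw [hpdeg] at this
    rw [hq, coeff_C_mul, this, mul_one]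
  have hqnorm : ∀ n ≤ m, ‖(q n).eval 0‖ ^ 2 = d n := fun n hn => by
    rw [hq, eval_mul, eval_C, norm_mul, Complex.norm_real, Real.norm_of_nonneg (hτpos n).le]
    simp only [hτ, if_pos hn]
    rw [div_mul_cancel₀ _ (norm_ne_zero_iff.2 (hp0 n hn)), Real.sq_sqrt (hdpos n hn).le]
  choose a ha using fun j => exists_coeff_eq_sum_of_natDegree_eq hqdeg hqne (j + 1) (X * q j)
    (by rw [natDegree_X_mul (hqne j), hqdeg])
  have hsub : ∀ j, a j (j + 1) = ((τ j / τ (j + 1) : ℝ) : ℂ) := by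
    intro j
    have h1 := congrArg (fun s => coeff s (j + 1)) (ha j)
    simp only [coeff_X_mul, hqlead, finsetSum_coeff, coeff_C_mul] at h1
    rw [Finset.sum_range_succ, hqlead, Finset.sum_eq_zero, zero_add] at h1
    · push_cast
      rw [h1, mul_div_cancel_right₀ _ (hτC _)]
    · intro i hi
      rw [Finset.mem_range] at hi
      rw [coeff_eq_zero_of_natDegree_lt (by rw [hqdeg]; exact hi), mul_zero]
  set H : ℕ → ℕ → ℂ := fun i j => if i ≤ j + 1 then a j i else 0 with hH
  have hHsub : ∀ j, H (j + 1) j = ((τ j / τ (j + 1) : ℝ) : ℂ) := fun j => by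
    rw [hH, ← hsub]
    exact if_pos le_rfl
  have hHzero : ∀ i j, j + 1 < i → H i j = 0 := fun i j h => if_neg (by omega)
  have hX : ∀ j, X * q j = ∑ i ∈ Finset.range (j + 2), C (H i j) * q i := fun j => by
    rw [ha j]
    refine Finset.sum_congr rfl fun i hi => ?_
    rw [Finset.mem_range] at hi
    simp only [hH]
    rw [if_pos (by omega)]
  refine ⟨q, H, hq0, hqdeg, hqne, fun i hi h => ?_, hHzero, fun j => ?_, hX, fun J hJ => ?_,
    fun n => ?_⟩
  · have := hqnorm i hi
    rw [h, norm_zero] at this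
    linarith [hdpos i hi, this]
  · rw [hHsub, Complex.ofReal_re, Complex.ofReal_im]
    exact ⟨div_pos (hτpos _) (hτpos _), rfl⟩
  · induction J with
    | zero =>
      rw [zero_add, Finset.sum_range_one, hqnorm 0 hJ]
      exact (div_self (by positivity)).symm
    | succ J ih =>
      rw [Finset.sum_range_succ, ih (by omega), hqnorm _ hJ]
      simp only [hd]
      ring
  · rw [charpoly_hessenberg hq0 hHzero hX]
    have hprod : ∀ n, (∏ i ∈ Finset.range n, H (i + 1) i) * τ n = 1 := by
      intro n
      induction n with
      | zero => simp [hτ0]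
      | succ n ih =>
        rw [Finset.prod_range_succ, hHsub, ← ih]
        push_cast
        rw [mul_assoc, div_mul_cancel₀ _ (hτC _)]
    rw [← map_prod, hq, ← mul_assoc, ← C_mul, hprod, C_1, one_mul]

/-- The `t`-th standard basis vector, which is `0` if `t` is out of range. -/
def stdVec (N t : ℕ) : Fin N → ℂ := fun i => if (i : ℕ) = t then 1 else 0

/-- The normalized initial vectors of the cycles, with prescribed coordinates `g k` with respect to
the Arnoldi basis of the preceding cycle. -/
noncomputable def startVec (N m : ℕ) (g : ℕ → ℕ → ℂ) : ℕ → Fin N → ℂ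
  | 0 => stdVec N 0
  | k + 1 => g k 0 • startVec N m g k +
      ∑ i ∈ Finset.range m, g k (i + 1) • stdVec N (k * m + (i + 1))

/-- The Arnoldi basis of cycle `k`. -/
noncomputable def cycleVec (N m : ℕ) (g : ℕ → ℕ → ℂ) (k j : ℕ) : Fin N → ℂ :=
  if j = 0 then startVec N m g k else stdVec N (k * m + j)

variable {N m : ℕ} {g : ℕ → ℕ → ℂ}

lemma cycleVec_zero (k : ℕ) : cycleVec N m g k 0 = startVec N m g k := if_pos rfl

lemma cycleVec_of_ne_zero (k : ℕ) {j : ℕ} (hj : j ≠ 0) :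
    cycleVec N m g k j = stdVec N (k * m + j) := if_neg hj

lemma startVec_succ (k : ℕ) : startVec N m g (k + 1) =
    ∑ i ∈ Finset.range (m + 1), g k i • cycleVec N m g k i := by
  rw [Finset.sum_range_succ', cycleVec_zero, startVec, add_comm]
  rfl

lemma startVec_apply_of_lt (k : ℕ) (i : Fin N) (hi : k * m < i) : startVec N m g k i = 0 := by
  induction k with
  | zero => exact if_neg (by omega)
  | succ k ih =>
    rw [add_mul, one_mul] at hi
    rw [startVec, Pi.add_apply, Pi.smul_apply, ih (by omega), smul_zero, zero_add,
      Finset.sum_apply]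
    refine Finset.sum_eq_zero fun j hj => ?_
    rw [Finset.mem_range] at hj
    rw [Pi.smul_apply, stdVec, if_neg (by omega), smul_zero]

lemma cycleVec_apply_of_lt (k j : ℕ) (i : Fin N) (hi : k * m + j < i) :
    cycleVec N m g k j i = 0 := by
  rcases eq_or_ne j 0 with rfl | hj
  · rw [cycleVec_zero, startVec_apply_of_lt k i hi]
  · rw [cycleVec_of_ne_zero k hj, stdVec, if_neg (by omega)]

lemma startVec_apply_ne_zero (hm : 1 ≤ m) (k : ℕ) (hg : ∀ l < k, g l m ≠ 0) (i : Fin N)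
    (hi : (i : ℕ) = k * m) : startVec N m g k i ≠ 0 := by
  cases k with
  | zero =>
    rw [startVec, stdVec, if_pos (by omega)]
    exact one_ne_zero
  | succ k =>
    rw [add_mul, one_mul] at hi
    rw [startVec_succ, Finset.sum_range_succ, Pi.add_apply, Finset.sum_apply, Finset.sum_eq_zero,
      zero_add, Pi.smul_apply, cycleVec_of_ne_zero k (by omega), stdVec, if_pos hi, smul_eq_mul,
      mul_one]
    · exact hg k (by omega)
    · intro j hj
      rw [Finset.mem_range] at hj
      rw [Pi.smul_apply, cycleVec_apply_of_lt k j i (by omega), smul_zero]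

lemma cycleVec_apply_ne_zero (hm : 1 ≤ m) (k j : ℕ) (hg : ∀ l < k, g l m ≠ 0) (i : Fin N)
    (hi : (i : ℕ) = k * m + j) : cycleVec N m g k j i ≠ 0 := by
  rcases eq_or_ne j 0 with rfl | hj
  · rw [cycleVec_zero]
    exact startVec_apply_ne_zero hm k hg i hi
  · rw [cycleVec_of_ne_zero k hj, stdVec, if_pos hi]
    exact one_ne_zero

lemma star_stdVec_dotProduct {t : ℕ} (ht : t < N) (x : Fin N → ℂ) :
    star (stdVec N t) ⬝ᵥ x = x ⟨t, ht⟩ := by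
  rw [dotProduct, Finset.sum_eq_single ⟨t, ht⟩]
  · simp [stdVec]
  · intro b _ hb
    have : (b : ℕ) ≠ t := fun h => hb (Fin.ext h)
    simp [stdVec, this]
  · simp

lemma star_cycleVec_dotProduct_cycleVec {k J : ℕ} (hJ : k * m + J < N)
    (hs : star (startVec N m g k) ⬝ᵥ startVec N m g k = 1) (i : ℕ) (hi : i ≤ J) (j : ℕ)
    (hj : j ≤ J) :
    star (cycleVec N m g k i) ⬝ᵥ cycleVec N m g k j = if i = j then 1 else 0 := by
  have hstd : ∀ i ≤ J, i ≠ 0 → ∀ j, j ≤ i → star (cycleVec N m g k i) ⬝ᵥ cycleVec N m g k j =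
      if i = j then 1 else 0 := by
    intro i hi hi0 j hj
    rw [cycleVec_of_ne_zero k hi0, star_stdVec_dotProduct (by omega)]
    split_ifs with h
    · rw [← h, cycleVec_of_ne_zero k hi0, stdVec, if_pos rfl]
    · exact cycleVec_apply_of_lt k j _ (by simp only; omega)
  rcases le_total j i with h | h
  · rcases eq_or_ne i 0 with rfl | hi0
    · obtain rfl : j = 0 := by omega
      rw [cycleVec_zero, hs, if_pos rfl]
    · exact hstd i hi hi0 j h
  · rcases eq_or_ne j 0 with rfl | hj0
    · obtain rfl : i = 0 := by omega
      rw [cycleVec_zero, hs, if_pos rfl]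
    · rw [star_dotProduct, hstd j hj hj0 i h]
      by_cases h' : i = j
      · simp [h']
      · simp [h', Ne.symm h']

lemma star_startVec_dotProduct_startVec (k : ℕ) (hk : k * m < N)
    (hg : ∀ l < k, ∑ i ∈ Finset.range (m + 1), star (g l i) * g l i = 1) :
    star (startVec N m g k) ⬝ᵥ startVec N m g k = 1 := by
  induction k with
  | zero =>
    rw [startVec, star_stdVec_dotProduct (by omega), stdVec, if_pos rfl]
  | succ k ih =>
    rw [add_mul, one_mul] at hk
    have hs := ih (by omega) fun l hl => hg l (by omega)
    rw [startVec_succ, star_sum_smul_dotProduct_sum_smul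
      (star_cycleVec_dotProduct_cycleVec (by omega) hs), hg k (by omega)]

lemma exists_mulVec_cycleVec_eq {ℓ : ℕ} (hm : 1 ≤ m) (hN : N = ℓ * m)
    (hg : ∀ l, l + 1 < ℓ → g l m ≠ 0) (T : ℕ → ℕ → Fin N → ℂ) :
    ∃ A : Matrix (Fin N) (Fin N) ℂ, ∀ k < ℓ, ∀ j < m, A *ᵥ cycleVec N m g k j = T k j := by
  set B : Matrix (Fin N) (Fin N) ℂ :=
    Matrix.of fun i t => cycleVec N m g (t / m) (t % m) i with hB
  have hdet : IsUnit B.det := by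
    rw [det_of_isUpperTriangular, isUnit_iff_ne_zero, Finset.prod_ne_zero_iff]
    · intro t _
      refine cycleVec_apply_ne_zero hm _ _ (fun l hl => hg l ?_) t (Nat.div_add_mod' t m).symm
      have : (t : ℕ) / m < ℓ := (Nat.div_lt_iff_lt_mul hm).2 (hN ▸ t.2)
      omega
    · intro i t hit
      refine cycleVec_apply_of_lt _ _ _ ?_
      rw [Nat.div_add_mod']
      exact hit
  refine ⟨(Matrix.of fun i (t : Fin N) => T (t / m) (t % m) i) * B⁻¹, fun k hk j hj => ?_⟩
  have ht : k * m + j < N := by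
    have := Nat.mul_le_mul_right m (Nat.succ_le_of_lt hk)
    rw [Nat.succ_mul] at this
    omega
  have h1 : (k * m + j) / m = k := by
    rw [mul_comm, Nat.mul_add_div (by omega), Nat.div_eq_of_lt hj, add_zero]
  have h2 : (k * m + j) % m = j := by
    rw [mul_comm, Nat.mul_add_mod, Nat.mod_eq_of_lt hj]
  have h3 : cycleVec N m g k j = B *ᵥ Pi.single ⟨k * m + j, ht⟩ 1 := by
    ext i
    simp [hB, h1, h2]
  rw [h3, mulVec_mulVec, mul_assoc, nonsing_inv_mul _ hdet, mul_one]
  ext i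
  simp [h1, h2]

end Construction

/-- **Prescribed Ritz values of each cycle of restarted GMRES.**
Given residual norms `f k j` (cycles `k = 0, …, ℓ-1`, steps `j = 0, …, m-1`), strictly
decreasing within each cycle and at the transitions, and arbitrary nonzero prescribed Ritz
values `θ k j i` (`i = 0, …, j-1`) for each cycle `k` and each step `1 ≤ j ≤ m`, there exist
`A ∈ ℂ^{n×n}` (`n = ℓ m`), `b`, matrices `V k ∈ ℂ^{n×m}` with orthonormal columns, unit
vectors `w k` orthogonal to the columns of `V k`, and upper Hessenberg matrices
`Hb k ∈ ℂ^{(m+1)×m}` with positive subdiagonal, such that `b = f 0 0 • (V 0) e₁`,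
`A (V k) = [V k, w k] (Hb k)` for `k + 1 < ℓ`, `A (V (ℓ-1)) = (V (ℓ-1)) H^(ℓ-1)` where
`H^(k)` is the `m × m` leading part of `Hb k`, restarted GMRES applied to `A x = b` produces
residuals with `‖r k j‖ = f k j`, and for every cycle `k` and step `j` the characteristic
polynomial of the `j × j` leading principal submatrix of `H^(k)` is `∏ i (X - θ k j i)`. -/
theorem prescribed_ritz_values_restarted_gmres
    (m ℓ : ℕ) (hm : 1 ≤ m) (hl : 1 ≤ ℓ)
    (f : ℕ → ℕ → ℝ)
    (hpos : ∀ k < ℓ, ∀ j < m, 0 < f k j)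
    (hdec : ∀ k < ℓ, ∀ j : ℕ, j + 1 < m → f k (j + 1) < f k j)
    (htrans : ∀ k : ℕ, k + 1 < ℓ → f (k + 1) 0 < f k (m - 1))
    (θ : ℕ → ℕ → ℕ → ℂ)
    (hθ : ∀ k < ℓ, ∀ j : ℕ, 1 ≤ j → j ≤ m → ∀ i < j, θ k j i ≠ 0) :
    ∃ (A : Matrix (Fin (ℓ * m)) (Fin (ℓ * m)) ℂ) (b : Fin (ℓ * m) → ℂ)
      (V : ℕ → Matrix (Fin (ℓ * m)) (Fin m) ℂ) (w : ℕ → (Fin (ℓ * m) → ℂ))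
      (Hb : ℕ → Matrix (Fin (m + 1)) (Fin m) ℂ)
      (r : ℕ → ℕ → (Fin (ℓ * m) → ℂ)) (rstart : ℕ → (Fin (ℓ * m) → ℂ)),
      (∀ k < ℓ, (V k)ᴴ * V k = 1) ∧
      (∀ k : ℕ, k + 1 < ℓ → norm2 (w k) = 1 ∧ (V k)ᴴ *ᵥ w k = 0) ∧
      (∀ k < ℓ, ∀ (i : Fin (m + 1)) (j : Fin m), (j : ℕ) + 1 < (i : ℕ) → Hb k i j = 0) ∧
      (∀ k < ℓ, ∀ j : Fin m, 0 < (Hb k j.succ j).re ∧ (Hb k j.succ j).im = 0) ∧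
      b = ((f 0 0 : ℝ) : ℂ) • (fun i => V 0 i ⟨0, hm⟩) ∧
      (∀ k : ℕ, k + 1 < ℓ →
        A * V k = (Matrix.of fun i (j : Fin (m + 1)) =>
          if h : (j : ℕ) < m then V k i ⟨j, h⟩ else w k i) * Hb k) ∧
      A * V (ℓ - 1) = V (ℓ - 1) * ((Hb (ℓ - 1)).submatrix Fin.castSucc id) ∧
      rstart 0 = b ∧
      (∀ k j : ℕ, IsGMRESResidual A (rstart k) j (r k j)) ∧
      (∀ k : ℕ, rstart (k + 1) = r k m) ∧
      (∀ k < ℓ, ∀ j < m, norm2 (r k j) = f k j) ∧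
      (∀ k < ℓ, ∀ j : ℕ, (hj1 : 1 ≤ j) → (hj2 : j ≤ m) →
        Matrix.charpoly (Matrix.of fun a b : Fin j =>
          Hb k ⟨a.1, by have ha := a.2; omega⟩ ⟨b.1, by have hb := b.2; omega⟩) =
        ∏ i : Fin j, (X - Polynomial.C (θ k j i.1))) := by
  set N := ℓ * m with hN
  have hlast : ∀ k < ℓ, k * m + m ≤ N := fun k hk => by
    have := Nat.mul_le_mul_right m (Nat.succ_le_of_lt hk)
    rwa [Nat.succ_mul] at this
  have hnext : ∀ k, k + 1 < ℓ → k * m + m < N := fun k hk => by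
    have := hlast (k + 1) hk
    rw [add_mul, one_mul] at this
    omega
  -- Residual norms, extended to the last step of every cycle.
  set F : ℕ → ℕ → ℝ := fun k j =>
    if j < m then f k j else if k + 1 < ℓ then f (k + 1) 0 else f k (m - 1) / 2 with hF
  have hFlt : ∀ k j, j < m → F k j = f k j := fun k j hj => if_pos hj
  have hFm : ∀ k, k + 1 < ℓ → F k m = f (k + 1) 0 := fun k hk => by simp [hF, hk]
  have hFpos : ∀ k < ℓ, ∀ j ≤ m, 0 < F k j := by
    intro k hk j hj
    simp only [hF]
    split_ifs with h1 h2
    · exact hpos k hk j h1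
    · exact hpos _ h2 0 hm
    · exact half_pos (hpos k hk _ (by omega))
  have hFdec : ∀ k < ℓ, ∀ j < m, F k (j + 1) < F k j := by
    intro k hk j hj
    rw [hFlt k j hj]
    simp only [hF]
    split_ifs with h1 h2
    · exact hdec k hk j h1
    · obtain rfl : j = m - 1 := by omega
      exact htrans k h2
    · obtain rfl : j = m - 1 := by omega
      exact half_lt_self (hpos k hk _ hj)
  have hθ' : ∀ k < ℓ, ∀ j ≤ m, ∀ i < j, θ k j i ≠ 0 := fun k hk j hj i hi =>
    hθ k hk j (by omega) hj i hi
  choose! q H hq0 hqdeg hqne hqeval hHzero hHsub hHX hqsum hHchar using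
    fun k (hk : k < ℓ) => exists_hessenberg m (F k) (hFpos k hk) (hFdec k hk) (θ k) (hθ' k hk)
  set g : ℕ → ℕ → ℂ := fun k i => ((F k m / F k 0 : ℝ) : ℂ) * star ((q k i).eval 0) with hg
  have hgm : ∀ k, k + 1 < ℓ → g k m ≠ 0 := by
    intro k hk
    have hk' : k < ℓ := by omega
    refine mul_ne_zero ?_ (star_ne_zero.2 (hqeval k hk' m le_rfl))
    exact_mod_cast (div_pos (hFpos k hk' m le_rfl) (hFpos k hk' 0 (by omega))).ne'
  have hgsum : ∀ k < ℓ, ∑ i ∈ Finset.range (m + 1), star (g k i) * g k i = 1 := by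
    intro k hk
    have h1 := (hFpos k hk m le_rfl).ne'
    have h2 := (hFpos k hk 0 (by omega)).ne'
    have h3 : ∀ i, star (g k i) * g k i =
        (((F k m / F k 0) ^ 2 * ‖(q k i).eval 0‖ ^ 2 : ℝ) : ℂ) := by
      intro i
      rw [Complex.star_def, Complex.conj_mul', ← Complex.ofReal_pow]
      congr 1
      simp only [hg]
      rw [norm_mul, norm_star, Complex.norm_real, mul_pow, Real.norm_eq_abs, sq_abs]
    rw [Finset.sum_congr rfl fun i _ => h3 i, ← Complex.ofReal_sum, ← Finset.mul_sum,
      hqsum k hk m le_rfl, ← Complex.ofReal_one]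
    congr 1
    field_simp
  set v : ℕ → ℕ → Fin N → ℂ := cycleVec N m g with hv
  have horth : ∀ k < ℓ, ∀ J, k * m + J < N → ∀ i ≤ J, ∀ j ≤ J,
      star (v k i) ⬝ᵥ v k j = if i = j then 1 else 0 := fun k hk J hJ =>
    star_cycleVec_dotProduct_cycleVec hJ
      (star_startVec_dotProduct_startVec k (by omega) fun l hl => hgsum l (by omega))
  obtain ⟨A, hA⟩ := exists_mulVec_cycleVec_eq hm hN hgm
    fun k j => ∑ i ∈ Finset.range (m + 1), H k i j • v k i
  have hA' : ∀ k < ℓ, ∀ j < m, A *ᵥ v k j = ∑ i ∈ Finset.range (j + 2), H k i j • v k i := by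
    intro k hk j hj
    rw [hA k hk j hj]
    symm
    refine Finset.sum_subset (fun i hi => ?_) fun i _ hi => ?_
    · rw [Finset.mem_range] at hi ⊢
      omega
    · rw [Finset.mem_range] at hi
      rw [hHzero k hk i j (by omega), zero_smul]
  choose R hR using exists_isGMRESResidual A
  have hres : ∀ k < ℓ, ∀ J ≤ m, k * m + J < N →
      R (((F k 0 : ℝ) : ℂ) • v k 0) J = ((F k J ^ 2 / F k 0 : ℝ) : ℂ) •
        ∑ i ∈ Finset.range (J + 1), star ((q k i).eval 0) • v k i ∧
      norm2 (R (((F k 0 : ℝ) : ℂ) • v k 0) J) = F k J := by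
    intro k hk J hJ hJN
    have horthJ := horth k hk J hJN
    refine isGMRESResidual_eq_sum (hqdeg k hk) (hqne k hk) horthJ
      (aeval_mulVec_eq_of_arnoldi (hq0 k hk) (hHX k hk) (fun j _ h => ?_)
        fun j hj => hA' k hk j (by omega))
      (hFpos k hk 0 (by omega)) (hFpos k hk J hJ) (hqsum k hk J hJ) (hR _ _)
    have := (hHsub k hk j).1
    rw [h, Complex.zero_re] at this
    exact this.false
  have hrestart : ∀ k < ℓ, (fun x => R x m)^[k] (((f 0 0 : ℝ) : ℂ) • v 0 0) =
      ((F k 0 : ℝ) : ℂ) • v k 0 := by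
    intro k
    induction k with
    | zero => exact fun _ => by rw [Function.iterate_zero_apply, hFlt 0 0 hm]
    | succ k ih =>
      intro hk
      have hk' : k < ℓ := by omega
      rw [Function.iterate_succ_apply', ih hk', (hres k hk' m le_rfl (hnext k hk)).1,
        hFlt (k + 1) 0 hm, ← hFm k hk, hv, cycleVec_zero, startVec_succ, Finset.smul_sum,
        Finset.smul_sum]
      refine Finset.sum_congr rfl fun i _ => ?_
      rw [smul_smul, smul_smul, hg]
      congr 1
      push_cast
      ring
  refine ⟨A, ((f 0 0 : ℝ) : ℂ) • v 0 0, fun k => Matrix.of fun i j => v k j i,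
    fun k => v k m, fun k => Matrix.of fun i j => H k i j,
    fun k j => R ((fun x => R x m)^[k] (((f 0 0 : ℝ) : ℂ) • v 0 0)) j,
    fun k => (fun x => R x m)^[k] (((f 0 0 : ℝ) : ℂ) • v 0 0),
    fun k hk => ?_, fun k hk => ⟨?_, ?_⟩, fun k hk i j hij => hHzero k hk i j hij,
    fun k hk j => hHsub k hk j, rfl, fun k hk => ?_, ?_, rfl, fun k j => hR _ _,
    fun k => Function.iterate_succ_apply' _ _ _, fun k hk j hj => ?_,
    fun k hk j _ _ => hHchar k hk j⟩
  · ext i j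
    have := hlast k hk
    refine (horth k hk (m - 1) (by omega) i (by omega) j (by omega)).trans ?_
    simp [one_apply, Fin.ext_iff]
  · have h1 := horth k (by omega) m (hnext k hk) m le_rfl m le_rfl
    rw [if_pos rfl, ← norm2_sq, ← Complex.ofReal_one, Complex.ofReal_inj] at h1
    exact (pow_eq_one_iff_of_nonneg (norm2_nonneg _) two_ne_zero).1 h1
  · ext i
    refine (horth k (by omega) m (hnext k hk) i (by omega) m le_rfl).trans ?_
    rw [if_neg (by omega)]
    rfl
  · ext i j
    refine (congrFun (hA k (by omega) j j.2) i).trans ?_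
    rw [Finset.sum_apply, ← Fin.sum_univ_eq_sum_range (fun a => (H k a j • v k a) i), mul_apply]
    refine Finset.sum_congr rfl fun a _ => ?_
    simp only [of_apply, Pi.smul_apply, smul_eq_mul]
    split_ifs with h
    · exact mul_comm _ _
    · have ha : (a : ℕ) = m := by omega
      rw [ha, mul_comm]
  · ext i j
    refine (congrFun (hA (ℓ - 1) (by omega) j j.2) i).trans ?_
    have hzero : v (ℓ - 1) m i = 0 := by
      have : (ℓ - 1) * m + m = N := by
        rw [← Nat.succ_mul, Nat.succ_eq_add_one, Nat.sub_add_cancel hl]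
      rw [hv, cycleVec_of_ne_zero _ (by omega), stdVec, if_neg (by omega)]
    rw [Finset.sum_range_succ, Pi.add_apply, Pi.smul_apply, hzero, smul_zero, add_zero,
      Finset.sum_apply, ← Fin.sum_univ_eq_sum_range (fun a => (H (ℓ - 1) a j • v (ℓ - 1) a) i),
      mul_apply]
    refine Finset.sum_congr rfl fun a _ => ?_
    simp [mul_comm]
  · have := hlast k hk
    simp only
    rw [hrestart k hk, (hres k hk j hj.le (by omega)).2, hFlt k j hj]
end

section
/- Prescribed convergence of restarted block GMRES with prescribed spectrum: Let p, M, ℓ ≥ 1 and n = ℓMp. Let {F_j^(k)} (j = 0,…,M−1; k = 1,…,ℓ) be upper triangular p×p matrices with positive real diagonal entries, non-increasing within each cycle and strictly decreasing at each transition between consecutive cycles in the Loewner sense (i.e., (F_{M−1}^(k))*F_{M−1}^(k) − (F₀^(k+1))*F₀^(k+1) is positive definite for k = 1,…,ℓ−1), and let λ₁, …, λ_n be arbitrary nonzero complex numbers. Then there exist a matrix A ∈ ℂ^{n×n} whose characteristic polynomial is ∏_{i=1}^n (z − λ_i) and a right-hand side B ∈ ℂ^{n×p} such that restarted block GMRES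 with cycle length M applied to AX = B produces block residuals satisfying (R_j^(k))* R_j^(k) = (F_j^(k))* F_j^(k) for all j = 0,…,M−1 and k = 1,…,ℓ; in particular, the eigenvalues of A can be assigned independently of the prescribed sequence of block residual normalizing quantities. -/
open Matrix ComplexOrder

/-- The Frobenius norm of a complex matrix. -/
noncomputable def frobNorm {n q : ℕ} (M : Matrix (Fin n) (Fin q) ℂ) : ℝ :=
  Real.sqrt (∑ i, ∑ c, ‖M i c‖ ^ 2)

/-- The block Krylov subspace `K_j(A, R0)`: the span of the columns of
`[R0, A R0, …, A^{j-1} R0]`. -/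
noncomputable def blockKrylov {n p : ℕ} (A : Matrix (Fin n) (Fin n) ℂ)
    (R0 : Matrix (Fin n) (Fin p) ℂ) (j : ℕ) : Submodule ℂ (Fin n → ℂ) :=
  Submodule.span ℂ {v | ∃ i : ℕ, i < j ∧ ∃ c : Fin p, v = fun r => ((A ^ i) * R0) r c}

/-- All columns of `X` lie in the submodule `S`. -/
def colsIn {n p : ℕ} (S : Submodule ℂ (Fin n → ℂ)) (X : Matrix (Fin n) (Fin p) ℂ) : Prop :=
  ∀ c : Fin p, (fun i => X i c) ∈ S

/-- `R` is the block GMRES residual at step `j` for `A` and initial block residual `R0`. -/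
def IsBlockGMRESResidual {n p : ℕ} (A : Matrix (Fin n) (Fin n) ℂ)
    (R0 : Matrix (Fin n) (Fin p) ℂ) (j : ℕ) (R : Matrix (Fin n) (Fin p) ℂ) : Prop :=
  (∃ X : Matrix (Fin n) (Fin p) ℂ, colsIn (blockKrylov A R0 j) X ∧ R = R0 - A * X) ∧
  ∀ X' : Matrix (Fin n) (Fin p) ℂ, colsIn (blockKrylov A R0 j) X' →
    frobNorm R ≤ frobNorm (R0 - A * X')

lemma frobNorm_le_frobNorm_add_of_orthogonal {n p : ℕ} (R Y : Matrix (Fin n) (Fin p) ℂ)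
    (h : Rᴴ * Y = 0) : frobNorm R ≤ frobNorm (R + Y) := by
  refine Real.sqrt_le_sqrt ?_
  rw [Finset.sum_comm, Finset.sum_comm (f := fun i c => ‖(R + Y) i c‖ ^ 2)]
  refine Finset.sum_le_sum fun c _ => ?_
  have hc : ∑ i, (Y i c * star (R i c)).re = 0 := by
    have := congr_arg Complex.re (congr_fun (congr_fun h c) c)
    simpa [Matrix.mul_apply, mul_comm] using this
  have key : ∑ i, ‖(R + Y) i c‖ ^ 2
      = ∑ i, ‖R i c‖ ^ 2 + ∑ i, ‖Y i c‖ ^ 2 + 2 * ∑ i, (Y i c * star (R i c)).re := by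
    rw [Finset.mul_sum, ← Finset.sum_add_distrib, ← Finset.sum_add_distrib]
    refine Finset.sum_congr rfl fun i _ => ?_
    rw [add_comm R Y, Matrix.add_apply]
    simp only [← Complex.normSq_eq_norm_sq, Complex.normSq_add]
    simp
    ring
  rw [key, hc]
  have : 0 ≤ ∑ i, ‖Y i c‖ ^ 2 := by positivity
  linarith

section ColsIn

variable {n p : ℕ} {S : Submodule ℂ (Fin n → ℂ)} {X Y : Matrix (Fin n) (Fin p) ℂ}

lemma colsIn.add (hX : colsIn S X) (hY : colsIn S Y) : colsIn S (X + Y) :=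
  fun c => S.add_mem (hX c) (hY c)

lemma colsIn.sub (hX : colsIn S X) (hY : colsIn S Y) : colsIn S (X - Y) :=
  fun c => S.sub_mem (hX c) (hY c)

lemma colsIn.mul_right (hX : colsIn S X) (C : Matrix (Fin p) (Fin p) ℂ) : colsIn S (X * C) := by
  intro c
  have : (fun i => (X * C) i c) = ∑ a, C a c • fun i => X i a := by
    ext i
    simp [Matrix.mul_apply, mul_comm]
  rw [this]
  exact S.sum_mem fun a _ => S.smul_mem _ (hX a)

lemma colsIn.of_mul_right {C : Matrix (Fin p) (Fin p) ℂ} (hC : IsUnit C.det)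
    (h : colsIn S (X * C)) : colsIn S X := by
  simpa [Matrix.mul_assoc, Matrix.mul_nonsing_inv _ hC] using h.mul_right C⁻¹

lemma colsIn.mono {T : Submodule ℂ (Fin n → ℂ)} (hST : S ≤ T) (hX : colsIn S X) : colsIn T X :=
  fun c => hST (hX c)

lemma colsIn_zero : colsIn S (0 : Matrix (Fin n) (Fin p) ℂ) := fun _ => S.zero_mem

end ColsIn

section Krylov

variable {n p : ℕ} {A : Matrix (Fin n) (Fin n) ℂ} {R₀ : Matrix (Fin n) (Fin p) ℂ}

lemma blockKrylov_mono {i j : ℕ} (hij : i ≤ j) : blockKrylov A R₀ i ≤ blockKrylov A R₀ j :=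
  Submodule.span_mono fun _ ⟨m, hm, c, hv⟩ => ⟨m, hm.trans_le hij, c, hv⟩

lemma colsIn_blockKrylov_self : colsIn (blockKrylov A R₀ 1) R₀ :=
  fun c => Submodule.subset_span ⟨0, one_pos, c, by simp⟩

lemma colsIn_blockKrylov_mul {j : ℕ} {X : Matrix (Fin n) (Fin p) ℂ}
    (hX : colsIn (blockKrylov A R₀ j) X) : colsIn (blockKrylov A R₀ (j + 1)) (A * X) := by
  intro c
  have hle : blockKrylov A R₀ j ≤ (blockKrylov A R₀ (j + 1)).comap A.mulVecLin := by
    refine Submodule.span_le.2 ?_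
    rintro _ ⟨m, hm, c, rfl⟩
    refine Submodule.subset_span ⟨m + 1, by omega, c, ?_⟩
    rw [pow_succ', Matrix.mul_assoc]
    rfl
  exact hle (hX c)

lemma blockKrylov_le {j : ℕ} {S : Submodule ℂ (Fin n → ℂ)}
    (h : ∀ i < j, colsIn S (A ^ i * R₀)) : blockKrylov A R₀ j ≤ S := by
  refine Submodule.span_le.2 ?_
  rintro _ ⟨m, hm, c, rfl⟩
  exact h m hm c

/-- A residual orthogonal to `A K_j(A, R₀)` is the block GMRES residual. -/
lemma isBlockGMRESResidual_of_orthogonal {j : ℕ} {X : Matrix (Fin n) (Fin p) ℂ}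
    (hX : colsIn (blockKrylov A R₀ j) X)
    (horth : ∀ x ∈ blockKrylov A R₀ j, (R₀ - A * X)ᴴ *ᵥ (A *ᵥ x) = 0) :
    IsBlockGMRESResidual A R₀ j (R₀ - A * X) := by
  refine ⟨⟨X, hX, rfl⟩, fun X' hX' => ?_⟩
  have h : (R₀ - A * X)ᴴ * (A * (X - X')) = 0 := by
    ext a c
    exact congr_fun (horth _ (hX.sub hX' c)) a
  convert frobNorm_le_frobNorm_add_of_orthogonal _ _ h using 2
  rw [Matrix.mul_sub]
  abel

lemma exists_isBlockGMRESResidual (A : Matrix (Fin n) (Fin n) ℂ) (R₀ : Matrix (Fin n) (Fin p) ℂ)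
    (j : ℕ) : ∃ R, IsBlockGMRESResidual A R₀ j R := by
  let f : (Fin n → ℂ) →ₗ[ℂ] EuclideanSpace ℂ (Fin n) :=
    (WithLp.linearEquiv 2 ℂ (Fin n → ℂ)).symm.toLinearMap ∘ₗ A.mulVecLin
  have key : ∀ c : Fin p, ∃ x ∈ blockKrylov A R₀ j, ∀ y ∈ blockKrylov A R₀ j,
      inner ℂ (f y) (WithLp.toLp 2 (fun i => R₀ i c) - f x) = 0 := by
    intro c
    obtain ⟨_, ⟨x, hx, rfl⟩, z, hz, hxz⟩ :=
      ((blockKrylov A R₀ j).map f).exists_add_mem_mem_orthogonal (WithLp.toLp 2 (fun i => R₀ i c))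
    refine ⟨x, hx, fun y hy => ?_⟩
    rw [hxz, add_sub_cancel_left]
    exact hz _ ⟨y, hy, rfl⟩
  choose x hx hxy using key
  refine ⟨_, isBlockGMRESResidual_of_orthogonal (X := Matrix.of fun i c => x c i) hx
    fun y hy => ?_⟩
  ext c
  have := congr_arg star (hxy c y hy)
  simpa [f, EuclideanSpace.inner_eq_star_dotProduct, Matrix.mulVec, dotProduct, Matrix.mul_apply,
    mul_comm, mul_sub, Finset.sum_sub_distrib] using this

lemma isBlockGMRESResidual_zero (A : Matrix (Fin n) (Fin n) ℂ) (j : ℕ) :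
    IsBlockGMRESResidual A (0 : Matrix (Fin n) (Fin p) ℂ) j 0 := by
  simpa using isBlockGMRESResidual_of_orthogonal (A := A)
    (R₀ := (0 : Matrix (Fin n) (Fin p) ℂ)) (j := j) colsIn_zero (by simp)

end Krylov

open scoped MatrixOrder in
lemma Matrix.PosSemidef.exists_conjTranspose_mul_self_eq {p : ℕ} {G : Matrix (Fin p) (Fin p) ℂ}
    (hG : G.PosSemidef) : ∃ D : Matrix (Fin p) (Fin p) ℂ, Dᴴ * D = G := by
  obtain ⟨X, hX, -, rfl⟩ := CFC.exists_sqrt_of_isSelfAdjoint_of_quasispectrumRestricts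
    hG.isHermitian (QuasispectrumRestricts.nnreal_of_nonneg hG.nonneg)
  exact ⟨X, by rw [← Matrix.star_eq_conjTranspose, hX.star_eq]⟩

section Blocks

variable (N p : ℕ)

/-- The `s`-th block of `p` consecutive columns of the identity matrix of size `N * p`, blocks being
numbered from `1`; it vanishes for `s = 0` and for `s > N`. -/
def unitBlock (s : ℕ) : Matrix (Fin (N * p)) (Fin p) ℂ :=
  Matrix.of fun i c => if (i : ℕ) + p = s * p + c then 1 else 0

variable {N p}

lemma unitBlock_eq_zero {s : ℕ} (hs : s = 0 ∨ N < s) : unitBlock N p s = 0 := by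
  ext i c
  have hi := i.2
  have hc := c.2
  simp only [unitBlock, Matrix.of_apply, Matrix.zero_apply, ite_eq_right_iff, one_ne_zero, imp_false]
  rcases hs with rfl | hs
  · omega
  · have : (N + 1) * p ≤ s * p := Nat.mul_le_mul_right p hs
    rw [add_mul] at this
    omega

lemma eq_and_eq_of_mul_add_eq {p s s' c c' : ℕ} (hc : c < p) (hc' : c' < p)
    (h : s * p + c = s' * p + c') : s = s' ∧ c = c' := by
  have hp : 0 < p := by omega
  have h1 := congr_arg (· / p) h
  have h2 := congr_arg (· % p) h
  simp only [Nat.mul_comm _ p, Nat.mul_add_div hp, Nat.div_eq_of_lt hc, Nat.div_eq_of_lt hc',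
    Nat.mul_add_mod, Nat.mod_eq_of_lt hc, Nat.mod_eq_of_lt hc'] at h1 h2
  omega

lemma unitBlock_conjTranspose_mul_of_ne {s s' : ℕ} (h : s ≠ s') :
    (unitBlock N p s)ᴴ * unitBlock N p s' = 0 := by
  ext c c'
  rw [Matrix.mul_apply]
  refine Finset.sum_eq_zero fun i _ => ?_
  simp only [unitBlock, Matrix.conjTranspose_apply, Matrix.of_apply]
  split_ifs with h1 h2
  · exact absurd (eq_and_eq_of_mul_add_eq c.2 c'.2 (h1.symm.trans h2)).1 h
  all_goals simp

lemma unitBlock_conjTranspose_mul_self {s : ℕ} (h1 : 1 ≤ s) (h2 : s ≤ N) :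
    (unitBlock N p s)ᴴ * unitBlock N p s = 1 := by
  ext c c'
  have hlt : (s - 1) * p + c < N * p := by
    have : (s - 1 + 1) * p ≤ N * p := Nat.mul_le_mul_right p (by omega)
    rw [add_mul] at this
    omega
  have hs : s * p = (s - 1) * p + p := by
    conv_lhs => rw [← Nat.sub_add_cancel h1, add_mul, one_mul]
  rw [Matrix.mul_apply, Finset.sum_eq_single (⟨(s - 1) * p + c, hlt⟩ : Fin (N * p))]
  · have e : (s - 1) * p + c + p = s * p + c := by omega
    simp [unitBlock, Matrix.one_apply, e, Fin.ext_iff]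
  · intro i _ hi
    have : (i : ℕ) + p ≠ s * p + c := fun h => hi (Fin.ext (by simp; omega))
    simp [unitBlock, this]
  · simp

lemma eq_top_of_colsIn_unitBlock {S : Submodule ℂ (Fin (N * p) → ℂ)}
    (h : ∀ s, 1 ≤ s → s ≤ N → colsIn S (unitBlock N p s)) : S = ⊤ := by
  refine eq_top_iff.2 fun x _ => ?_
  rw [pi_eq_sum_univ x]
  refine S.sum_mem fun i _ => S.smul_mem _ ?_
  have hp : 0 < p := Nat.pos_of_mul_pos_left (i.pos)
  have := h (i / p + 1) (Nat.le_add_left 1 _) (Nat.div_lt_of_lt_mul (i.2.trans_eq (mul_comm N p)))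
    ⟨i % p, Nat.mod_lt _ hp⟩
  convert this using 2 with j
  have hd := Nat.div_add_mod' i p
  simp only [unitBlock, Matrix.of_apply, add_mul, one_mul, Fin.ext_iff]
  congr 1
  apply propext
  omega

end Blocks

/-- The diagonal entries indexed by the `t`-th block (counted from `0`). -/
def blockEntries {N p : ℕ} (lam : Fin (N * p) → ℂ) (t : ℕ) : Fin p → ℂ :=
  fun a => if h : t * p + a < N * p then lam ⟨t * p + a, h⟩ else 1

lemma blockEntries_ne_zero {N p : ℕ} {lam : Fin (N * p) → ℂ} (hlam : ∀ i, lam i ≠ 0) (t : ℕ)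
    (a : Fin p) : blockEntries lam t a ≠ 0 := by
  unfold blockEntries
  split_ifs
  · exact hlam _
  · exact one_ne_zero

/-- A block sequence `u` that is a lower bidiagonal chain for `w`, where the columns of the `w t`
span the whole space, determines a matrix with `A u_t = w_t` whose spectrum is the diagonal
of the chain. -/
lemma exists_matrix_of_block_chain {N p : ℕ} (hp : 1 ≤ p) (lam : Fin (N * p) → ℂ)
    (u w : ℕ → Matrix (Fin (N * p)) (Fin p) ℂ)
    (huw : ∀ t < N, u t * Matrix.diagonal (blockEntries lam t) + u (t + 1) = w t)
    (hu : u N = 0)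
    (hw : ∀ S : Submodule ℂ (Fin (N * p) → ℂ), (∀ t < N, colsIn S (w t)) → S = ⊤) :
    ∃ A : Matrix (Fin (N * p)) (Fin (N * p)) ℂ,
      A.charpoly = ∏ i, (Polynomial.X - Polynomial.C (lam i)) ∧ ∀ t < N, A * u t = w t := by
  let col : Fin (N * p) → Fin p := fun m => ⟨m % p, Nat.mod_lt _ hp⟩
  let U : Matrix (Fin (N * p)) (Fin (N * p)) ℂ := Matrix.of fun i m => u (m / p) i (col m)
  let V : Matrix (Fin (N * p)) (Fin (N * p)) ℂ := Matrix.of fun i m => w (m / p) i (col m)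
  let L : Matrix (Fin (N * p)) (Fin (N * p)) ℂ := Matrix.of fun m' m =>
    (if m' = m then lam m else 0) + if (m' : ℕ) = m + p then 1 else 0
  have hdiv : ∀ m : Fin (N * p), (m : ℕ) / p < N := fun m =>
    Nat.div_lt_of_lt_mul (m.2.trans_eq (mul_comm N p))
  have hUL : U * L = V := by
    ext i m
    simp only [V, ← huw _ (hdiv m), Matrix.add_apply, Matrix.mul_diagonal, Matrix.of_apply]
    simp only [Matrix.mul_apply, L, Matrix.of_apply, mul_add, Finset.sum_add_distrib, mul_ite,
      mul_zero, mul_one, Finset.sum_ite_eq', Finset.mem_univ, if_true]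
    congr 1
    · have hm : (m : ℕ) / p * p + m % p = m := Nat.div_add_mod' _ _
      simp [U, col, blockEntries, hm]
    · by_cases h : (m : ℕ) + p < N * p
      · rw [Finset.sum_eq_single (⟨m + p, h⟩ : Fin (N * p))]
        · simp [U, col, Nat.add_div_right _ hp]
        · intro b _ hb
          rw [if_neg fun h' => hb (Fin.ext h')]
        · simp
      · rw [Finset.sum_eq_zero]
        · have : (m : ℕ) / p + 1 = N := by
            refine le_antisymm (hdiv m) ?_
            rw [← Nat.add_div_right _ hp]
            exact (Nat.le_div_iff_mul_le hp).2 (by omega)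
          rw [this, hu, Matrix.zero_apply]
        · intro b _
          have := b.2
          rw [if_neg (by omega)]
  have hcol : ∀ t < N, ∀ c : Fin p, ∃ m : Fin (N * p), (m : ℕ) / p = t ∧ col m = c := by
    intro t ht c
    have hlt : t * p + c < N * p := by
      have : (t + 1) * p ≤ N * p := Nat.mul_le_mul_right p ht
      rw [add_mul] at this
      omega
    refine ⟨⟨t * p + c, hlt⟩, ?_, Fin.ext (by simp [col, Nat.mod_eq_of_lt c.2])⟩
    rw [Fin.val_mk, mul_comm, Nat.mul_add_div hp, Nat.div_eq_of_lt c.2, add_zero]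
  have hV : IsUnit V := by
    have hrange : LinearMap.range V.mulVecLin = ⊤ := by
      refine hw _ fun t ht c => ?_
      obtain ⟨m, rfl, rfl⟩ := hcol t ht c
      exact ⟨Pi.single m 1, by rw [Matrix.mulVecLin_apply, Matrix.mulVec_single_one]; rfl⟩
    exact Matrix.mulVec_surjective_iff_isUnit.1 (LinearMap.range_eq_top.1 hrange)
  have hU : IsUnit U := by
    rw [Matrix.isUnit_iff_isUnit_det] at hV ⊢
    rw [← hUL, Matrix.det_mul] at hV
    exact isUnit_of_mul_isUnit_left hV
  have hUdet := (Matrix.isUnit_iff_isUnit_det _).1 hU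
  have hL : L.charpoly = ∏ i, (Polynomial.X - Polynomial.C (lam i)) := by
    rw [← Matrix.charpoly_transpose, Matrix.charpoly_of_isUpperTriangular]
    · refine Finset.prod_congr rfl fun i _ => ?_
      simp [L, Nat.ne_of_gt hp]
    · intro i j hij
      have hij' : (j : ℕ) < i := hij
      have h1 : j ≠ i := by rintro rfl; omega
      have h2 : (j : ℕ) ≠ i + p := by omega
      simp [L, h1, h2]
  refine ⟨U * L * U⁻¹, ?_, fun t ht => ?_⟩
  · rw [Matrix.charpoly_mul_comm, Matrix.nonsing_inv_mul_cancel_left _ _ hUdet, hL]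
  · have hAU : U * L * U⁻¹ * U = V := by
      rw [Matrix.nonsing_inv_mul_cancel_right _ _ hUdet, hUL]
    ext i c
    obtain ⟨m, rfl, rfl⟩ := hcol t ht c
    exact congr_fun (congr_fun hAU i) m

/-- Residuals of one GMRES cycle, given a bidiagonal chain `u` starting at the initial residual whose
images `A u_i` are block upper bidiagonal in terms of the blocks `W`. -/
lemma isBlockGMRESResidual_of_chain {n p : ℕ} {A : Matrix (Fin n) (Fin n) ℂ}
    {R₀ R : Matrix (Fin n) (Fin p) ℂ} (j : ℕ) (u W : ℕ → Matrix (Fin n) (Fin p) ℂ)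
    {Γ : Matrix (Fin p) (Fin p) ℂ} {Λ C Z D : ℕ → Matrix (Fin p) (Fin p) ℂ}
    (h0 : u 0 = R₀ * Γ) (hΓ : IsUnit Γ.det)
    (hu : ∀ i < j, A * u i = u i * Λ i + u (i + 1))
    (hw : ∀ i < j, A * u i = W (i + 1) * C i + W i * Z i)
    (hC : ∀ i < j, IsUnit (C i).det) (hZ : Z 0 = 0)
    (hR : R₀ - R = ∑ i ∈ Finset.range j, W (i + 1) * D i)
    (horth : ∀ i, 1 ≤ i → i ≤ j → Rᴴ * W i = 0) :
    IsBlockGMRESResidual A R₀ j R := by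
  have hK : ∀ i < j, colsIn (blockKrylov A R₀ (i + 1)) (u i) := by
    intro i
    induction i with
    | zero => exact fun _ => h0 ▸ colsIn_blockKrylov_self.mul_right Γ
    | succ i ih =>
      intro hi
      have hui := ih (by omega)
      have : u (i + 1) = A * u i - u i * Λ i := by rw [hu i (by omega), add_sub_cancel_left]
      rw [this]
      exact (colsIn_blockKrylov_mul hui).sub ((hui.mul_right _).mono (blockKrylov_mono (by omega)))
  have hX : ∀ i < j, ∃ X, colsIn (blockKrylov A R₀ j) X ∧ A * X = W (i + 1) := by
    intro i
    induction i with
    | zero =>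
      intro hj
      refine ⟨u 0 * (C 0)⁻¹, ((hK 0 hj).mono (blockKrylov_mono hj)).mul_right _, ?_⟩
      rw [← Matrix.mul_assoc, hw 0 hj, hZ, Matrix.mul_zero, add_zero,
        Matrix.mul_nonsing_inv_cancel_right _ _ (hC 0 hj)]
    | succ i ih =>
      intro hi
      obtain ⟨X, hXK, hX⟩ := ih (by omega)
      refine ⟨(u (i + 1) - X * Z (i + 1)) * (C (i + 1))⁻¹,
        (((hK _ hi).mono (blockKrylov_mono hi)).sub (hXK.mul_right _)).mul_right _, ?_⟩
      rw [← Matrix.mul_assoc, Matrix.mul_sub, hw _ hi, ← Matrix.mul_assoc, hX, add_sub_cancel_right,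
        Matrix.mul_nonsing_inv_cancel_right _ _ (hC _ hi)]
  choose! X hXK hX using hX
  have hRX : R = R₀ - A * ∑ i ∈ Finset.range j, X i * D i := by
    rw [Matrix.mul_sum, eq_sub_iff_add_eq', ← eq_sub_iff_add_eq, hR]
    refine Finset.sum_congr rfl fun i hi => ?_
    rw [← Matrix.mul_assoc, hX i (Finset.mem_range.1 hi)]
  let T := LinearMap.ker (Rᴴ * A).mulVecLin
  have hT : ∀ {Y : Matrix (Fin n) (Fin p) ℂ}, Rᴴ * (A * Y) = 0 → colsIn T Y := by
    intro Y hY c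
    rw [← Matrix.mul_assoc] at hY
    exact funext fun a => congr_fun (congr_fun hY a) c
  have huT : ∀ i m, m + i < j → colsIn T (A ^ i * u m) := by
    intro i
    induction i with
    | zero =>
      intro m hm
      refine hT ?_
      rw [pow_zero, Matrix.one_mul, hw m hm, Matrix.mul_add, ← Matrix.mul_assoc, ← Matrix.mul_assoc,
        horth (m + 1) (by omega) hm, Matrix.zero_mul, zero_add]
      rcases Nat.eq_zero_or_pos m with rfl | hm0
      · rw [hZ, Matrix.mul_zero]
      · rw [horth m hm0 (by omega), Matrix.zero_mul]
    | succ i ih =>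
      intro m hm
      rw [pow_succ, Matrix.mul_assoc, hu m (by omega), Matrix.mul_add, ← Matrix.mul_assoc]
      exact ((ih m (by omega)).mul_right _).add (ih (m + 1) (by omega))
  have hKT : blockKrylov A R₀ j ≤ T := blockKrylov_le fun i hi => by
    refine colsIn.of_mul_right hΓ ?_
    rw [Matrix.mul_assoc, ← h0]
    exact huT i 0 (by omega)
  rw [hRX]
  refine isBlockGMRESResidual_of_orthogonal ?_ fun x hx => ?_
  · intro c
    have : (fun i => (∑ k ∈ Finset.range j, X k * D k) i c)
        = ∑ k ∈ Finset.range j, fun i => (X k * D k) i c := by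
      ext i
      simp [Matrix.sum_apply]
    rw [this]
    exact Submodule.sum_mem _ fun k hk => (hXK k (Finset.mem_range.1 hk)).mul_right _ c
  · rw [← hRX, Matrix.mulVec_mulVec]
    exact hKT hx

section Construction

variable (N : ℕ) {p : ℕ} (D : ℕ → Matrix (Fin p) (Fin p) ℂ)

/-- The block vector with components `D s` for `t < s ≤ N` and zero components for `s ≤ t`. -/
def blockTail (t : ℕ) : Matrix (Fin (N * p)) (Fin p) ℂ :=
  ∑ s ∈ Finset.Ico t N, unitBlock N p (s + 1) * D (s + 1)

variable {N}

lemma blockTail_eq_zero {t : ℕ} (ht : N ≤ t) : blockTail N D t = 0 := by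
  simp [blockTail, Finset.Ico_eq_empty_of_le ht]

lemma blockTail_eq_add (t : ℕ) :
    blockTail N D t = unitBlock N p (t + 1) * D (t + 1) + blockTail N D (t + 1) := by
  by_cases ht : t < N
  · exact Finset.sum_eq_sum_Ico_succ_bot ht _
  · rw [blockTail_eq_zero D (by omega), blockTail_eq_zero D (by omega),
      unitBlock_eq_zero (by omega)]
    simp

lemma blockTail_sub_blockTail_add (t j : ℕ) : blockTail N D t - blockTail N D (t + j) =
    ∑ i ∈ Finset.range j, unitBlock N p (t + (i + 1)) * D (t + (i + 1)) := by
  induction j with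
  | zero => simp
  | succ j ih =>
    rw [Finset.sum_range_succ, ← ih, blockTail_eq_add D (t + j)]
    simp only [← add_assoc]
    abel

lemma unitBlock_conjTranspose_mul_blockTail {s t : ℕ} (h : s ≤ t) :
    (unitBlock N p s)ᴴ * blockTail N D t = 0 := by
  rw [blockTail, Matrix.mul_sum]
  refine Finset.sum_eq_zero fun r hr => ?_
  have := (Finset.mem_Ico.1 hr).1
  rw [← Matrix.mul_assoc, unitBlock_conjTranspose_mul_of_ne (by omega), Matrix.zero_mul]

lemma blockTail_conjTranspose_mul_unitBlock {s t : ℕ} (h : s ≤ t) :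
    (blockTail N D t)ᴴ * unitBlock N p s = 0 := by
  simpa using congr_arg Matrix.conjTranspose (unitBlock_conjTranspose_mul_blockTail (N := N) D h)

lemma blockTail_conjTranspose_mul_self {G : ℕ → Matrix (Fin p) (Fin p) ℂ}
    (hD : ∀ t < N, (D (t + 1))ᴴ * D (t + 1) = G t - G (t + 1)) (hG : G N = 0) {t : ℕ}
    (ht : t ≤ N) : (blockTail N D t)ᴴ * blockTail N D t = G t := by
  induction ht using Nat.decreasingInduction with
  | self => simp [blockTail_eq_zero, hG]
  | of_succ t ht ih =>
    rw [blockTail_eq_add, Matrix.conjTranspose_add, Matrix.conjTranspose_mul, Matrix.add_mul,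
      Matrix.mul_add, Matrix.mul_add, ih, Matrix.mul_assoc, ← Matrix.mul_assoc (unitBlock N p _)ᴴ,
      unitBlock_conjTranspose_mul_self (by omega) ht, Matrix.one_mul, hD t ht, Matrix.mul_assoc,
      unitBlock_conjTranspose_mul_blockTail D le_rfl, Matrix.mul_zero, ← Matrix.mul_assoc,
      blockTail_conjTranspose_mul_unitBlock D le_rfl, Matrix.zero_mul]
    abel

/-- If the `D s` at the ends of the cycles of length `M` are invertible, there is a matrix with
prescribed nonzero eigenvalues for which restarted block GMRES started at `blockTail N D 0` produces
the residuals `blockTail N D t`. -/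
lemma exists_matrix_blockTail_residuals (hp : 1 ≤ p) {M : ℕ} (hMN : M ∣ N)
    (hD : ∀ s, 1 ≤ s → s ≤ N → M ∣ s → IsUnit (D s).det) {lam : Fin (N * p) → ℂ}
    (hlam : ∀ i, lam i ≠ 0) :
    ∃ A : Matrix (Fin (N * p)) (Fin (N * p)) ℂ,
      A.charpoly = ∏ i, (Polynomial.X - Polynomial.C (lam i)) ∧
      ∀ t j, M ∣ t → t + j ≤ N →
        IsBlockGMRESResidual A (blockTail N D t) j (blockTail N D (t + j)) := by
  let W := unitBlock N p
  let Λ : ℕ → Matrix (Fin p) (Fin p) ℂ := fun t => Matrix.diagonal (blockEntries lam t)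
  let γ : ℕ → Fin p → ℂ := fun t => ∏ i ∈ Finset.range t, -blockEntries lam i
  let Γ : ℕ → Matrix (Fin p) (Fin p) ℂ := fun t => Matrix.diagonal (γ t)
  let E : ℕ → Matrix (Fin p) (Fin p) ℂ := fun t => if M ∣ t then 0 else 1 + D t * Γ t
  let u : ℕ → Matrix (Fin (N * p)) (Fin p) ℂ := fun t => blockTail N D t * Γ t + W t * E t
  let C : ℕ → Matrix (Fin p) (Fin p) ℂ := fun t => E t - D t * Γ t
  let w : ℕ → Matrix (Fin (N * p)) (Fin p) ℂ := fun t => W (t + 1) * C (t + 1) + W t * (E t * Λ t)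
  have hΓsucc : ∀ t, Γ (t + 1) = -(Γ t * Λ t) := by
    intro t
    simp only [Γ, Λ, γ, Finset.prod_range_succ, Matrix.diagonal_mul_diagonal, Matrix.diagonal_neg]
    congr 1
    ext a
    simp
  have hΓ : ∀ t, IsUnit (Γ t).det := by
    intro t
    simp only [Γ, γ, Matrix.det_diagonal, isUnit_iff_ne_zero, Finset.prod_apply]
    exact Finset.prod_ne_zero_iff.2 fun a _ => Finset.prod_ne_zero_iff.2 fun i _ =>
      neg_ne_zero.2 (blockEntries_ne_zero hlam i a)
  have hC : ∀ s, 1 ≤ s → s ≤ N → IsUnit (C s).det := by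
    intro s h1 hs
    by_cases hMs : M ∣ s
    · simp only [C, E, if_pos hMs, zero_sub, ← Matrix.mul_neg, Matrix.det_mul, Matrix.det_neg]
      exact (hD s h1 hs hMs).mul (((isUnit_one.neg).pow _).mul (hΓ s))
    · simp [C, E, hMs]
  have huw : ∀ t, u t * Λ t + u (t + 1) = w t := by
    intro t
    simp only [u, w, C, blockTail_eq_add D t, hΓsucc, Matrix.add_mul, Matrix.mul_sub,
      Matrix.mul_neg, Matrix.mul_assoc, W]
    abel
  have huN : u N = 0 := by simp [u, E, hMN, blockTail_eq_zero]
  have hspan : ∀ S : Submodule ℂ (Fin (N * p) → ℂ), (∀ t < N, colsIn S (w t)) → S = ⊤ := by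
    intro S hS
    have hW : ∀ s ≤ N, colsIn S (W s) := by
      intro s
      induction s with
      | zero => exact fun _ => by simpa [W, unitBlock_eq_zero] using colsIn_zero
      | succ s ih =>
        intro hs
        refine colsIn.of_mul_right (hC (s + 1) (by omega) hs) ?_
        have := (hS s hs).sub ((ih (by omega)).mul_right (E s * Λ s))
        simpa [w] using this
    exact eq_top_of_colsIn_unitBlock fun s _ hs => hW s hs
  obtain ⟨A, hA, hAu⟩ := exists_matrix_of_block_chain hp lam u w (fun t _ => huw t) huN hspan
  refine ⟨A, hA, fun t j hMt htj => ?_⟩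
  have hEt : E t = 0 := if_pos hMt
  refine isBlockGMRESResidual_of_chain j (fun i => u (t + i)) (fun i => W (t + i)) (Γ := Γ t)
    (Λ := fun i => Λ (t + i)) (C := fun i => C (t + i + 1)) (Z := fun i => E (t + i) * Λ (t + i))
    (D := fun i => D (t + (i + 1))) ?_ (hΓ t) (fun i hi => ?_) (fun i hi => ?_) (fun i hi => ?_) ?_
    (blockTail_sub_blockTail_add D t j) (fun i _ hi => ?_)
  · simp [u, hEt]
  · rw [hAu _ (by omega), ← huw, add_assoc]
  · exact hAu _ (by omega)
  · exact hC _ (by omega) (by omega)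
  · simp [hEt]
  · exact blockTail_conjTranspose_mul_unitBlock D (by omega)

end Construction

/-- **Prescribed convergence of restarted block GMRES with prescribed spectrum.**
Given upper triangular `p×p` matrices `F k j` with positive real diagonal entries
(cycles `k = 0, …, ℓ-1`, steps `j = 0, …, M-1`), non-increasing within each cycle and strictly
decreasing at the transitions between consecutive cycles (in the Loewner sense on `F^*F`),
and arbitrary nonzero complex numbers `lam i` (`i = 0, …, n-1`, `n = ℓ M p`), there exist
`A ∈ ℂ^{n×n}` with characteristic polynomial `∏ i (z - lam i)` and `B ∈ ℂ^{n×p}` such that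
restarted block GMRES with cycle length `M` applied to `A X = B` produces block residuals with
`(R k j)^* (R k j) = (F k j)^* (F k j)`. -/
theorem prescribed_restarted_block_gmres_convergence_with_spectrum
    (p M ℓ : ℕ) (hp : 1 ≤ p) (hM : 1 ≤ M) (hl : 1 ≤ ℓ)
    (F : ℕ → ℕ → Matrix (Fin p) (Fin p) ℂ)
    (hFtri : ∀ k < ℓ, ∀ j < M, ∀ a b : Fin p, (b : ℕ) < (a : ℕ) → F k j a b = 0)
    (hFpos : ∀ k < ℓ, ∀ j < M, ∀ a : Fin p, 0 < (F k j a a).re ∧ (F k j a a).im = 0)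
    (hmono : ∀ k < ℓ, ∀ j : ℕ, j + 1 < M →
      ((F k j)ᴴ * F k j - (F k (j + 1))ᴴ * F k (j + 1)).PosSemidef)
    (htrans : ∀ k : ℕ, k + 1 < ℓ →
      ((F k (M - 1))ᴴ * F k (M - 1) - (F (k + 1) 0)ᴴ * F (k + 1) 0).PosDef)
    (lam : Fin (ℓ * M * p) → ℂ) (hlam : ∀ i, lam i ≠ 0) :
    ∃ (A : Matrix (Fin (ℓ * M * p)) (Fin (ℓ * M * p)) ℂ)
      (B : Matrix (Fin (ℓ * M * p)) (Fin p) ℂ)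
      (R : ℕ → ℕ → Matrix (Fin (ℓ * M * p)) (Fin p) ℂ)
      (Rstart : ℕ → Matrix (Fin (ℓ * M * p)) (Fin p) ℂ),
      A.charpoly = ∏ i : Fin (ℓ * M * p), (Polynomial.X - Polynomial.C (lam i)) ∧
      Rstart 0 = B ∧
      (∀ k j : ℕ, IsBlockGMRESResidual A (Rstart k) j (R k j)) ∧
      (∀ k : ℕ, Rstart (k + 1) = R k M) ∧
      (∀ k < ℓ, ∀ j < M, (R k j)ᴴ * R k j = (F k j)ᴴ * F k j) := by
  have hM0 : 0 < M := hM
  let G : ℕ → Matrix (Fin p) (Fin p) ℂ := fun t =>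
    if t < ℓ * M then (F (t / M) (t % M))ᴴ * F (t / M) (t % M) else 0
  have hG : ∀ k < ℓ, ∀ j < M, G (k * M + j) = (F k j)ᴴ * F k j := by
    intro k hk j hj
    have hlt : k * M + j < ℓ * M := by
      have : (k + 1) * M ≤ ℓ * M := Nat.mul_le_mul_right M hk
      rw [add_mul] at this
      omega
    have h1 : (k * M + j) / M = k := by
      rw [mul_comm, Nat.mul_add_div hM0, Nat.div_eq_of_lt hj, add_zero]
    have h2 : (k * M + j) % M = j := by rw [mul_comm, Nat.mul_add_mod, Nat.mod_eq_of_lt hj]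
    simp only [G, if_pos hlt, h1, h2]
  have hGN : G (ℓ * M) = 0 := if_neg (lt_irrefl _)
  have hdecomp : ∀ t < ℓ * M, t / M < ℓ ∧ t % M < M ∧ t / M * M + t % M = t := fun t ht =>
    ⟨Nat.div_lt_of_lt_mul (ht.trans_eq (mul_comm _ _)), Nat.mod_lt _ hM0, Nat.div_add_mod' t M⟩
  have hFF : ∀ k < ℓ, ((F k (M - 1))ᴴ * F k (M - 1)).PosDef := by
    intro k hk
    have hdet : IsUnit (F k (M - 1)).det := by
      rw [Matrix.det_of_isUpperTriangular fun a b hab => hFtri k hk (M - 1) (by omega) a b hab,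
        isUnit_iff_ne_zero]
      refine Finset.prod_ne_zero_iff.2 fun a _ h => ?_
      have := (hFpos k hk (M - 1) (by omega) a).1
      simp [h] at this
    exact Matrix.PosDef.conjTranspose_mul_self _
      (Matrix.mulVec_injective_of_isUnit ((Matrix.isUnit_iff_isUnit_det _).2 hdet))
  have hboundary : ∀ t < ℓ * M, M ∣ t + 1 → (G t - G (t + 1)).PosDef := by
    rintro t ht ⟨k, hk⟩
    obtain ⟨k, rfl⟩ : ∃ k', k = k' + 1 := Nat.exists_eq_succ_of_ne_zero (by rintro rfl; omega)
    have hkl : k < ℓ := by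
      have : M * (k + 1) ≤ M * ℓ := by rw [← hk, mul_comm M ℓ]; exact ht
      exact Nat.le_of_mul_le_mul_left this hM0
    have hk1 : t + 1 = (k + 1) * M + 0 := by rw [hk, mul_comm, add_zero]
    have hk2 : t = k * M + (M - 1) := by rw [add_mul] at hk1; omega
    rw [hk1, hk2, hG k hkl _ (by omega)]
    by_cases hlast : k + 1 < ℓ
    · rw [hG (k + 1) hlast 0 hM0]
      exact htrans k hlast
    · have : k + 1 = ℓ := by omega
      rw [this, add_zero, hGN, sub_zero]
      exact hFF k hkl
  have hpsd : ∀ t < ℓ * M, (G t - G (t + 1)).PosSemidef := by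
    intro t ht
    by_cases hd : M ∣ t + 1
    · exact (hboundary t ht hd).posSemidef
    · obtain ⟨h1, h2, h3⟩ := hdecomp t ht
      have hj : t % M + 1 < M := by
        refine lt_of_le_of_ne h2 fun h => hd ⟨t / M + 1, ?_⟩
        rw [mul_add, mul_comm M]
        omega
      rw [← h3, add_assoc, hG _ h1 _ h2, hG _ h1 _ hj]
      exact hmono _ h1 _ hj
  have hfactor : ∀ t, ∃ D : Matrix (Fin p) (Fin p) ℂ, t < ℓ * M → Dᴴ * D = G t - G (t + 1) := by
    intro t
    by_cases ht : t < ℓ * M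
    · obtain ⟨D, hD⟩ := (hpsd t ht).exists_conjTranspose_mul_self_eq
      exact ⟨D, fun _ => hD⟩
    · exact ⟨0, fun h => absurd h ht⟩
  choose D₀ hD₀ using hfactor
  let D : ℕ → Matrix (Fin p) (Fin p) ℂ := fun s => D₀ (s - 1)
  have hD : ∀ t < ℓ * M, (D (t + 1))ᴴ * D (t + 1) = G t - G (t + 1) := hD₀
  have hDunit : ∀ s, 1 ≤ s → s ≤ ℓ * M → M ∣ s → IsUnit (D s).det := by
    intro s h1 hs hMs
    obtain ⟨t, rfl⟩ := Nat.exists_eq_add_of_le' h1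
    have h := (Matrix.isUnit_iff_isUnit_det _).1 (hboundary t hs hMs).isUnit
    rw [← hD t hs, Matrix.det_mul] at h
    exact isUnit_of_mul_isUnit_right h
  obtain ⟨A, hA, hres⟩ := exists_matrix_blockTail_residuals D hp (Dvd.intro_left ℓ rfl) hDunit hlam
  have hex : ∀ k j, ∃ R, IsBlockGMRESResidual A (blockTail (ℓ * M) D (k * M)) j R ∧
      (j ≤ M → R = blockTail (ℓ * M) D (k * M + j)) := by
    intro k j
    by_cases hj : j ≤ M
    · refine ⟨_, ?_, fun _ => rfl⟩
      by_cases hk : k < ℓ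
      · refine hres _ _ (Dvd.intro_left k rfl) ?_
        have : (k + 1) * M ≤ ℓ * M := Nat.mul_le_mul_right M hk
        rw [add_mul] at this
        omega
      · have : ℓ * M ≤ k * M := Nat.mul_le_mul_right M (by omega)
        rw [blockTail_eq_zero D this, blockTail_eq_zero D (by omega)]
        exact isBlockGMRESResidual_zero A j
    · obtain ⟨R, hR⟩ := exists_isBlockGMRESResidual A (blockTail (ℓ * M) D (k * M)) j
      exact ⟨R, hR, fun h => absurd h hj⟩
  choose R hR hRtail using hex
  refine ⟨A, _, R, fun k => blockTail (ℓ * M) D (k * M), hA, rfl, hR, fun k => ?_,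
    fun k hk j hj => ?_⟩
  · simp only [hRtail k M le_rfl, add_mul, one_mul]
  · have : (k + 1) * M ≤ ℓ * M := Nat.mul_le_mul_right M hk
    rw [add_mul] at this
    rw [hRtail k j hj.le, blockTail_conjTranspose_mul_self D hD hGN (by omega), hG k hk j hj]
end
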